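/- arXiv:0709.0517 — 2 statements merged into one kernel-verified Lean document; each statement's English description precedes it below -/
import Mathlib

section
/- (Square case reduction) Let A be an arbitrary n×n complex matrix. Let T and Ω be independent uniformly random subsets of {1,…,n} of fixed cardinalities |T| and |Ω|, and suppose δ ∈ [0,1] satisfies δ ≥ max{|T|, |Ω|}/n. Then for every u ≥ 0, P( ‖A_{ΩT}‖ ≥ u ) ≤ P( ‖P_δ A P'_δ‖ ≥ u ), where P_δ and P'_δ are independent random n×n diagonal 0–1 matrices each having exactly ⌊δn⌋ ones on the diagonal, with the positions of the ones chosen uniformly at random. -/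
attribute [local instance] Classical.propDecidable

/-- The spectral norm (ℓ2 → ℓ2 operator norm) of a complex matrix. -/
noncomputable def specNorm {α β : Type*} [Fintype α] [Fintype β] [DecidableEq β]
    (A : Matrix α β ℂ) : ℝ :=
  ‖LinearMap.toContinuousLinearMap (Matrix.toEuclideanLin A)‖

/-- The diagonal 0–1 projector matrix onto the coordinates in `S`. -/
def projMatrix {n : ℕ} (S : Finset (Fin n)) : Matrix (Fin n) (Fin n) ℂ :=
  Matrix.diagonal fun i => if i ∈ S then 1 else 0

/-- The probability that a random diagonal projector `R_δ`, whose diagonal entries are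
independent 0–1 Bernoulli variables of mean `δ`, projects onto a coordinate set satisfying
`p`.  (The Bernoulli product measure assigns mass `δ^|S| (1−δ)^{n−|S|}` to the set `S`.) -/
noncomputable def bernSetProb (n : ℕ) (δ : ℝ) (p : Finset (Fin n) → Prop) : ℝ :=
  ∑ S ∈ (Finset.univ : Finset (Fin n)).powerset.filter p,
    δ ^ S.card * (1 - δ) ^ (n - S.card)

/-- The probability that two independent Bernoulli(δ) random coordinate sets `S, S'`
(for `R_δ` and an independent copy `R'_δ`) satisfy `p`. -/
noncomputable def bernPairProb (n : ℕ) (δ : ℝ)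
    (p : Finset (Fin n) → Finset (Fin n) → Prop) : ℝ :=
  ∑ q ∈ ((Finset.univ : Finset (Fin n)).powerset ×ˢ
      (Finset.univ : Finset (Fin n)).powerset).filter fun q => p q.1 q.2,
    (δ ^ q.1.card * (1 - δ) ^ (n - q.1.card)) * (δ ^ q.2.card * (1 - δ) ^ (n - q.2.card))

/-- The expectation `E f(S, S')` over two independent Bernoulli(δ) random coordinate sets
`S, S'` (the coordinate sets of `R_δ` and an independent copy `R'_δ`). -/
noncomputable def bernPairExp (n : ℕ) (δ : ℝ)
    (f : Finset (Fin n) → Finset (Fin n) → ℝ) : ℝ :=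
  ∑ S ∈ (Finset.univ : Finset (Fin n)).powerset,
    ∑ S' ∈ (Finset.univ : Finset (Fin n)).powerset,
      (δ ^ S.card * (1 - δ) ^ (n - S.card)) * (δ ^ S'.card * (1 - δ) ^ (n - S'.card)) * f S S'

/-- The expectation `E f(S)` over a single Bernoulli(δ) random coordinate set `S` (the
coordinate set of `R_δ`). -/
noncomputable def bernExp (n : ℕ) (δ : ℝ) (f : Finset (Fin n) → ℝ) : ℝ :=
  ∑ S ∈ (Finset.univ : Finset (Fin n)).powerset,
    (δ ^ S.card * (1 - δ) ^ (n - S.card)) * f S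
/-- The probability that a uniformly random subset of `{1,…,n}` of fixed cardinality `m`
satisfies the predicate `p`. -/
noncomputable def uniformSetProb (n m : ℕ) (p : Finset (Fin n) → Prop) : ℝ :=
  (((Finset.powersetCard m (Finset.univ : Finset (Fin n))).filter p).card : ℝ) /
    ((Finset.powersetCard m (Finset.univ : Finset (Fin n))).card : ℝ)

/-- The probability that a pair of independent uniformly random subsets of `{1,…,n}` of fixed
cardinalities `m₁` and `m₂` satisfies the predicate `p`. -/
noncomputable def uniformPairProb (n m₁ m₂ : ℕ)
    (p : Finset (Fin n) → Finset (Fin n) → Prop) : ℝ :=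
  ((((Finset.powersetCard m₁ (Finset.univ : Finset (Fin n))) ×ˢ
      (Finset.powersetCard m₂ (Finset.univ : Finset (Fin n)))).filter
        fun q => p q.1 q.2).card : ℝ) /
    (((Finset.powersetCard m₁ (Finset.univ : Finset (Fin n))).card *
      (Finset.powersetCard m₂ (Finset.univ : Finset (Fin n))).card : ℕ) : ℝ)

theorem specNorm_submatrix_le {α β γ η : Type*} [Fintype α] [Fintype β] [Fintype γ] [Fintype η]
    [DecidableEq β] [DecidableEq η] (A : Matrix α β ℂ) {f : γ → α} {g : η → β}
    (hf : Function.Injective f) (hg : Function.Injective g) :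
    specNorm (A.submatrix f g) ≤ specNorm A := by
  refine ContinuousLinearMap.opNorm_le_bound _ (norm_nonneg _) fun x => ?_
  set y : EuclideanSpace ℂ β := WithLp.toLp 2 (Function.extend g x 0) with hy
  have hyx : ‖y‖ = ‖x‖ := by
    rw [EuclideanSpace.norm_eq, EuclideanSpace.norm_eq]
    congr 1
    symm
    refine Fintype.sum_of_injective g hg _ _ (fun j hj => ?_) fun j => ?_
    · simp [hy, Function.extend_apply' _ _ _ (by simpa using hj)]
    · simp [hy, hg.extend_apply]
  have hcoord (i : γ) : Matrix.toEuclideanLin (A.submatrix f g) x i =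
      Matrix.toEuclideanLin A y (f i) := by
    simp only [Matrix.toLpLin_apply, Matrix.mulVec, dotProduct, Matrix.submatrix_apply]
    refine Fintype.sum_of_injective g hg _ _ (fun j hj => ?_) fun j => ?_
    · simp [hy, Function.extend_apply' _ _ _ (by simpa using hj)]
    · simp [hy, hg.extend_apply]
  have hle : ‖Matrix.toEuclideanLin (A.submatrix f g) x‖ ≤ ‖Matrix.toEuclideanLin A y‖ := by
    rw [EuclideanSpace.norm_eq, EuclideanSpace.norm_eq]
    apply Real.sqrt_le_sqrt
    simp_rw [hcoord]
    rw [← Finset.sum_image (f := fun a => ‖Matrix.toEuclideanLin A y a‖ ^ 2) hf.injOn]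
    exact Finset.sum_le_sum_of_subset_of_nonneg (Finset.subset_univ _) fun _ _ _ => by positivity
  calc _ ≤ ‖Matrix.toEuclideanLin A y‖ := hle
    _ ≤ specNorm A * ‖y‖ :=
      (LinearMap.toContinuousLinearMap (Matrix.toEuclideanLin A)).le_opNorm y
    _ = _ := by rw [hyx]

theorem specNorm_submatrix_le_projMatrix {n : ℕ} (A : Matrix (Fin n) (Fin n) ℂ)
    {Ω T S S' : Finset (Fin n)} (hΩ : Ω ⊆ S) (hT : T ⊆ S') :
    specNorm (A.submatrix (fun ω : Ω => (ω : Fin n)) (fun t : T => (t : Fin n))) ≤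
      specNorm (projMatrix S * A * projMatrix S') := by
  have h : A.submatrix (fun ω : Ω => (ω : Fin n)) (fun t : T => (t : Fin n)) =
      (projMatrix S * A * projMatrix S').submatrix (fun ω : Ω => (ω : Fin n))
        (fun t : T => (t : Fin n)) := by
    ext ω t
    simp [projMatrix, hΩ ω.2, hT t.2]
  rw [h]
  exact specNorm_submatrix_le _ Subtype.val_injective Subtype.val_injective

theorem choose_le_card_powersetCard_filter_superset {α : Type*} [Fintype α] [DecidableEq α]
    (s : Finset α) {k : ℕ} (hk : s.card ≤ k) :
    (Fintype.card α - s.card).choose (k - s.card) ≤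
      ((Finset.powersetCard k Finset.univ).filter fun t => s ⊆ t).card := by
  rw [← Finset.card_compl, ← Finset.card_powersetCard]
  refine Finset.card_le_card_of_injOn (fun t => s ∪ t) (fun t ht => ?_) fun t ht t' ht' h => ?_
  · obtain ⟨hts, htc⟩ := Finset.mem_powersetCard.1 ht
    have hd : Disjoint s t := Finset.subset_compl_iff_disjoint_left.1 hts
    simp [Finset.card_union_of_disjoint hd, htc, hk]
  · have hd : Disjoint s t :=
      Finset.subset_compl_iff_disjoint_left.1 (Finset.mem_powersetCard.1 ht).1
    have hd' : Disjoint s t' :=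
      Finset.subset_compl_iff_disjoint_left.1 (Finset.mem_powersetCard.1 ht').1
    rw [← Finset.union_sdiff_cancel_left hd, ← Finset.union_sdiff_cancel_left hd']
    exact congrArg (· \ s) h

/-- Enlarging both set sizes can only increase the probability of an event that is inherited by
supersets. -/
theorem uniformPairProb_le_of_superset {n m₁ m₂ k₁ k₂ : ℕ} (h₁ : m₁ ≤ k₁) (h₂ : m₂ ≤ k₂)
    (hk₁ : k₁ ≤ n) (hk₂ : k₂ ≤ n) {p q : Finset (Fin n) → Finset (Fin n) → Prop}
    (hpq : ∀ s t s' t', s ⊆ s' → t ⊆ t' → p s t → q s' t') :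
    uniformPairProb n m₁ m₂ p ≤ uniformPairProb n k₁ k₂ q := by
  unfold uniformPairProb
  set 𝒜 := ((Finset.powersetCard m₁ (Finset.univ : Finset (Fin n))) ×ˢ
    (Finset.powersetCard m₂ Finset.univ)).filter fun x => p x.1 x.2 with h𝒜
  set ℬ := ((Finset.powersetCard k₁ (Finset.univ : Finset (Fin n))) ×ˢ
    (Finset.powersetCard k₂ Finset.univ)).filter fun x => q x.1 x.2 with hℬ
  have key : 𝒜.card * ((n - m₁).choose (k₁ - m₁) * (n - m₂).choose (k₂ - m₂)) ≤
      ℬ.card * (k₁.choose m₁ * k₂.choose m₂) := by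
    refine Finset.card_mul_le_card_mul
      (fun x y : Finset (Fin n) × Finset (Fin n) => x.1 ⊆ y.1 ∧ x.2 ⊆ y.2) ?_ ?_
    · rintro ⟨s, t⟩ hst
      simp only [h𝒜, Finset.mem_filter, Finset.mem_product, Finset.mem_powersetCard] at hst
      obtain ⟨⟨⟨-, rfl⟩, -, rfl⟩, hp⟩ := hst
      have hs := choose_le_card_powersetCard_filter_superset s h₁
      have ht := choose_le_card_powersetCard_filter_superset t h₂
      rw [Fintype.card_fin] at hs ht
      refine (Nat.mul_le_mul hs ht).trans ?_
      rw [← Finset.card_product]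
      refine Finset.card_le_card fun y hy => ?_
      simp only [Finset.mem_product, Finset.mem_filter] at hy
      simp only [Finset.bipartiteAbove, hℬ, Finset.mem_filter, Finset.mem_product]
      exact ⟨⟨⟨hy.1.1, hy.2.1⟩, hpq _ _ _ _ hy.1.2 hy.2.2 hp⟩, hy.1.2, hy.2.2⟩
    · rintro ⟨s, t⟩ hst
      simp only [hℬ, Finset.mem_filter, Finset.mem_product, Finset.mem_powersetCard] at hst
      obtain ⟨⟨⟨-, rfl⟩, -, rfl⟩, -⟩ := hst
      rw [← Finset.card_powersetCard, ← Finset.card_powersetCard, ← Finset.card_product]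
      refine Finset.card_le_card fun x hx => ?_
      simp only [Finset.bipartiteBelow, h𝒜, Finset.mem_filter, Finset.mem_product,
        Finset.mem_powersetCard] at hx ⊢
      exact ⟨⟨hx.2.1, hx.1.1.1.2⟩, hx.2.2, hx.1.1.2.2⟩
  simp only [Finset.card_powersetCard, Finset.card_univ, Fintype.card_fin]
  have pos {a b : ℕ} (h : a ≤ b) : 0 < b.choose a := Nat.choose_pos h
  have hc : 0 < (n - m₁).choose (k₁ - m₁) * (n - m₂).choose (k₂ - m₂) :=
    Nat.mul_pos (pos (by omega)) (pos (by omega))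
  have hm : 0 < n.choose m₁ * n.choose m₂ := Nat.mul_pos (pos (by omega)) (pos (by omega))
  have hk : 0 < n.choose k₁ * n.choose k₂ := Nat.mul_pos (pos hk₁) (pos hk₂)
  rw [div_le_div_iff₀ (by exact_mod_cast hm) (by exact_mod_cast hk)]
  norm_cast
  refine Nat.le_of_mul_le_mul_right ?_ hc
  have e₁ := Nat.choose_mul (n := n) h₁
  have e₂ := Nat.choose_mul (n := n) h₂
  calc _ = 𝒜.card * ((n - m₁).choose (k₁ - m₁) * (n - m₂).choose (k₂ - m₂)) *
        (n.choose k₁ * n.choose k₂) := by ring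
    _ ≤ ℬ.card * (k₁.choose m₁ * k₂.choose m₂) * (n.choose k₁ * n.choose k₂) :=
        Nat.mul_le_mul_right _ key
    _ = ℬ.card * ((n.choose k₁ * k₁.choose m₁) * (n.choose k₂ * k₂.choose m₂)) := by ring
    _ = _ := by rw [e₁, e₂]; ring

/-- **Square case reduction.**  For an arbitrary `n × n` matrix `A`, independent uniformly
random subsets `T, Ω` of fixed cardinalities, and `δ ∈ [0,1]` with `δ ≥ max{|T|,|Ω|}/n`,
`P(‖A_{ΩT}‖ ≥ u) ≤ P(‖P_δ A P'_δ‖ ≥ u)` for all `u ≥ 0`, where `P_δ, P'_δ` are independent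
uniformly random diagonal 0–1 projectors with exactly `⌊δn⌋` ones. -/
theorem stmt_13 (n : ℕ) (A : Matrix (Fin n) (Fin n) ℂ) (mT mΩ : ℕ) (δ : ℝ)
    (hδ0 : 0 ≤ δ) (hδ1 : δ ≤ 1) (hδ : ((max mT mΩ : ℕ) : ℝ) / n ≤ δ)
    (u : ℝ) (hu : 0 ≤ u) :
    uniformPairProb n mΩ mT
        (fun Ω T => u ≤ specNorm
          (A.submatrix (fun ω : Ω => (ω : Fin n)) (fun t : T => (t : Fin n)))) ≤
      uniformPairProb n ⌊δ * (n : ℝ)⌋₊ ⌊δ * (n : ℝ)⌋₊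
        (fun S S' => u ≤ specNorm (projMatrix S * A * projMatrix S')) := by
  have hkn : ⌊δ * (n : ℝ)⌋₊ ≤ n := Nat.floor_le_of_le (mul_le_of_le_one_left n.cast_nonneg hδ1)
  by_cases hm : max mT mΩ ≤ n
  · have hmk : max mT mΩ ≤ ⌊δ * (n : ℝ)⌋₊ := by
      rcases n.eq_zero_or_pos with rfl | hn
      · exact hm.trans (Nat.zero_le _)
      · exact Nat.le_floor ((div_le_iff₀ (by exact_mod_cast hn)).1 hδ)
    exact uniformPairProb_le_of_superset ((le_max_right _ _).trans hmk)
      ((le_max_left _ _).trans hmk) hkn hkn fun _ _ _ _ hΩ hT h =>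
        h.trans (specNorm_submatrix_le_projMatrix A hΩ hT)
  · have hz : n.choose mΩ * n.choose mT = 0 := by
      rcases lt_max_iff.1 (not_le.1 hm) with h | h <;> simp [Nat.choose_eq_zero_of_lt h]
    unfold uniformPairProb
    simp only [Finset.card_powersetCard, Finset.card_univ, Fintype.card_fin, hz, Nat.cast_zero,
      div_zero]
    positivity
end

section
/- (Random coordinate models) Fix δ ∈ [0,1] and let A be an arbitrary n×n complex matrix. Then for every u ≥ 0: P( ‖P_δ A‖ ≥ u ) ≤ 2 P( ‖R_δ A‖ ≥ u ), and consequently P( ‖P_δ A P'_δ‖ ≥ u ) ≤ 4 P( ‖R_δ A R'_δ‖ ≥ u ), where primed matrices denote independent copies. -/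
attribute [local instance] Classical.propDecidable

open Finset in
/-- If the terms of a finite sequence start nonnegative and change sign at most once, then
nonnegativity of `∑ i * f i` implies nonnegativity of `∑ f i`. -/
lemma sum_nonneg_of_single_crossing {N : ℕ} {f : ℕ → ℝ} (h0 : 0 ≤ f 0)
    (hcross : ∀ i j, i < j → j < N → f i < 0 → f j ≤ 0)
    (hsum : 0 ≤ ∑ i ∈ range N, (i : ℝ) * f i) : 0 ≤ ∑ i ∈ range N, f i := by
  by_cases hex : ∃ i, i < N ∧ f i < 0
  · obtain ⟨-, hneg⟩ := Nat.find_spec hex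
    have hmin : ∀ i < Nat.find hex, i < N → 0 ≤ f i := fun i hi hiN =>
      not_lt.1 fun h => Nat.find_min hex hi ⟨hiN, h⟩
    generalize Nat.find hex = I at hneg hmin
    have hI : (0 : ℝ) < I := by
      rcases Nat.eq_zero_or_pos I with rfl | hI
      · exact absurd hneg h0.not_gt
      · exact_mod_cast hI
    have hle : ∑ i ∈ range N, (i : ℝ) * f i ≤ I * ∑ i ∈ range N, f i := by
      rw [mul_sum]
      refine sum_le_sum fun i hi => ?_
      rw [mem_range] at hi
      rcases lt_trichotomy i I with h | rfl | h
      · exact mul_le_mul_of_nonneg_right (by exact_mod_cast h.le) (hmin i h hi)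
      · exact le_rfl
      · exact mul_le_mul_of_nonpos_right (by exact_mod_cast h.le) (hcross I i h hi hneg)
    exact nonneg_of_mul_nonneg_right (hsum.trans hle) hI
  · push Not at hex
    exact sum_nonneg fun i hi => hex i (mem_range.1 hi)

/-- The probability that a binomial variable with parameters `n` and `δ` equals `j`. -/
noncomputable def binomialWeight (n : ℕ) (δ : ℝ) (j : ℕ) : ℝ :=
  n.choose j * (δ ^ j * (1 - δ) ^ (n - j))

lemma binomialWeight_nonneg (n : ℕ) {δ : ℝ} (h0 : 0 ≤ δ) (h1 : δ ≤ 1) (j : ℕ) :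
    0 ≤ binomialWeight n δ j := by
  have := sub_nonneg.2 h1
  unfold binomialWeight
  positivity

lemma binomialWeight_of_lt {n j : ℕ} (δ : ℝ) (h : n < j) : binomialWeight n δ j = 0 := by
  simp [binomialWeight, Nat.choose_eq_zero_of_lt h]

lemma binomialWeight_succ (n : ℕ) (δ : ℝ) (j : ℕ) :
    ((j : ℝ) + 1) * (1 - δ) * binomialWeight n δ (j + 1) =
      ((n : ℝ) - j) * δ * binomialWeight n δ j := by
  rcases lt_trichotomy j n with h | rfl | h
  · obtain ⟨d, rfl⟩ := Nat.exists_eq_add_of_lt h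
    have hc := Nat.choose_succ_right_eq (j + d + 1) j
    rw [show j + d + 1 - j = d + 1 by omega] at hc
    have hc' : ((j + d + 1).choose (j + 1) : ℝ) * (j + 1) = (j + d + 1).choose j * (d + 1) := by
      exact_mod_cast hc
    unfold binomialWeight
    rw [show j + d + 1 - (j + 1) = d by omega, show j + d + 1 - j = d + 1 by omega]
    push_cast
    linear_combination (δ ^ (j + 1) * (1 - δ) ^ (d + 1)) * hc'
  · simp [binomialWeight_of_lt δ (Nat.lt_succ_self j)]
  · rw [binomialWeight_of_lt δ h, binomialWeight_of_lt δ (h.trans (Nat.lt_succ_self j))]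
    simp

open Finset in
lemma sum_binomialWeight (n : ℕ) (δ : ℝ) :
    ∑ j ∈ range (n + 1), binomialWeight n δ j = 1 := by
  have h := add_pow δ (1 - δ) n
  rw [add_sub_cancel, one_pow] at h
  rw [h]
  exact sum_congr rfl fun j _ => mul_comm _ _

open Finset in
lemma sum_mul_binomialWeight (n : ℕ) (δ : ℝ) :
    ∑ j ∈ range (n + 1), (j : ℝ) * binomialWeight n δ j = n * δ := by
  have hshift : ∑ j ∈ range (n + 1), ((j : ℝ) + 1) * binomialWeight n δ (j + 1) =
      ∑ j ∈ range (n + 1), (j : ℝ) * binomialWeight n δ j := by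
    have h := sum_range_succ' (fun j => (j : ℝ) * binomialWeight n δ j) (n + 1)
    rw [sum_range_succ, binomialWeight_of_lt δ (Nat.lt_succ_self n)] at h
    push_cast at h
    linarith
  have hrec : (1 - δ) * ∑ j ∈ range (n + 1), ((j : ℝ) + 1) * binomialWeight n δ (j + 1) =
      n * δ * ∑ j ∈ range (n + 1), binomialWeight n δ j -
        δ * ∑ j ∈ range (n + 1), (j : ℝ) * binomialWeight n δ j := by
    simp only [mul_sum, ← sum_sub_distrib]
    refine sum_congr rfl fun j _ => ?_
    linear_combination binomialWeight_succ n δ j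
  rw [hshift, sum_binomialWeight] at hrec
  linarith

/-- The increment of `binomialWeight n δ (m + i) - binomialWeight n δ (m - 1 - i)` in `i`, up to
a positive factor. -/
lemma binomialWeight_reflect_step {n m i : ℕ} (δ : ℝ) (hi : i + 1 < m) :
    ((m : ℝ) + i + 1) * (1 - δ) * (((n : ℝ) - m + i + 2) * δ) *
        (binomialWeight n δ (m + (i + 1)) - binomialWeight n δ (m - 1 - (i + 1))) =
      ((m : ℝ) ^ 2 - ((i : ℝ) + 1) ^ 2) * (1 - δ) ^ 2 *
          (binomialWeight n δ (m + i) - binomialWeight n δ (m - 1 - i)) +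
        binomialWeight n δ (m + i) *
          ((((n : ℝ) - m + 1) ^ 2 - ((i : ℝ) + 1) ^ 2) * δ ^ 2 -
            ((m : ℝ) ^ 2 - ((i : ℝ) + 1) ^ 2) * (1 - δ) ^ 2) := by
  obtain ⟨d, rfl⟩ := Nat.exists_eq_add_of_lt hi
  have h1 := binomialWeight_succ n δ (i + 1 + d + 1 + i)
  have h2 := binomialWeight_succ n δ d
  rw [show i + 1 + d + 1 + (i + 1) = i + 1 + d + 1 + i + 1 by omega,
    show i + 1 + d + 1 - 1 - (i + 1) = d by omega,
    show i + 1 + d + 1 - 1 - i = d + 1 by omega]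
  push_cast at h1 ⊢
  linear_combination ((n : ℝ) - (i + 1 + d + 1) + i + 2) * δ * h1 +
    ((i : ℝ) + 1 + d + 1 + i + 1) * (1 - δ) * h2

open Finset in
/-- A binomial variable whose mean is at least the integer `m` is at least `m` with probability
at least one half. -/
theorem half_le_sum_binomialWeight {n m : ℕ} {δ : ℝ} (h0 : 0 ≤ δ) (h1 : δ ≤ 1)
    (hm : (m : ℝ) ≤ δ * n) :
    1 / 2 ≤ ∑ i ∈ range (n + 1), binomialWeight n δ (m + i) := by
  have hw := binomialWeight_nonneg n h0 h1
  have hext : ∀ f : ℕ → ℝ, ∑ j ∈ range (m + (n + 1)), f j * binomialWeight n δ j =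
      ∑ j ∈ range (n + 1), f j * binomialWeight n δ j := fun f => by
    symm
    refine sum_subset (range_subset_range.2 (Nat.le_add_left _ _)) fun j _ hj => ?_
    rw [binomialWeight_of_lt δ (by simpa using hj), mul_zero]
  have htotal : ∑ j ∈ range m, binomialWeight n δ j +
      ∑ i ∈ range (n + 1), binomialWeight n δ (m + i) = 1 := by
    rw [← sum_range_add, ← sum_binomialWeight n δ]
    simpa using hext fun _ => 1
  have hmean : ∑ j ∈ range m, (j : ℝ) * binomialWeight n δ j +
      ∑ i ∈ range (n + 1), ((m : ℝ) + i) * binomialWeight n δ (m + i) = n * δ := by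
    have h := sum_range_add (fun j => (j : ℝ) * binomialWeight n δ j) m (n + 1)
    push_cast at h
    rw [← h, hext, sum_mul_binomialWeight]
  suffices hle : ∑ j ∈ range m, binomialWeight n δ j ≤
      ∑ i ∈ range (n + 1), binomialWeight n δ (m + i) by linarith
  have hmn : m ≤ n := by
    have : (m : ℝ) ≤ n := hm.trans (mul_le_of_le_one_left (by positivity) h1)
    exact_mod_cast this
  rcases Nat.eq_zero_or_pos m with rfl | hmpos
  · simpa using sum_nonneg fun i _ => hw _
  rcases h1.eq_or_lt with rfl | hlt
  · rw [sum_eq_zero fun j hj => ?_]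
    · exact sum_nonneg fun i _ => hw _
    · have : n - j ≠ 0 := by have := mem_range.1 hj; omega
      simp [binomialWeight, this]
  have hδ : 0 < δ := by
    refine h0.lt_of_ne' fun h => ?_
    have : (m : ℝ) ≤ 0 := by simpa [h] using hm
    exact absurd this (by push Not; exact_mod_cast hmpos)
  have hε : 0 < 1 - δ := sub_pos.2 hlt
  have hmnR : (m : ℝ) ≤ n := by exact_mod_cast hmn
  set f : ℕ → ℝ := fun i => binomialWeight n δ (m + i) - binomialWeight n δ (m - 1 - i) with hf
  set g : ℕ → ℝ := fun i => (((n : ℝ) - m + 1) ^ 2 - ((i : ℝ) + 1) ^ 2) * δ ^ 2 -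
    ((m : ℝ) ^ 2 - ((i : ℝ) + 1) ^ 2) * (1 - δ) ^ 2 with hg
  have hodds : (m : ℝ) * (1 - δ) ≤ ((n : ℝ) - m + 1) * δ := by nlinarith
  have hodds_sq : ((m : ℝ) * (1 - δ)) ^ 2 ≤ (((n : ℝ) - m + 1) * δ) ^ 2 :=
    pow_le_pow_left₀ (by positivity) hodds 2
  have hf0 : 0 ≤ f 0 := by
    obtain ⟨d, rfl⟩ := Nat.exists_eq_add_of_lt hmpos
    have h := binomialWeight_succ n δ d
    have hd := hw d
    simp only [hf, zero_add, add_zero, Nat.add_sub_cancel, Nat.sub_zero]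
    push_cast at hodds h
    have hpos : 0 < ((d : ℝ) + 1) * (1 - δ) := by positivity
    refine sub_nonneg.2 (le_of_mul_le_mul_left ?_ hpos)
    rw [h]
    refine mul_le_mul_of_nonneg_right ?_ hd
    linarith
  have hstep : ∀ i, i + 1 < m → (0 ≤ f i → 0 ≤ g i → 0 ≤ f (i + 1)) ∧
      (f i ≤ 0 → g i ≤ 0 → f (i + 1) ≤ 0) := by
    intro i hi
    have hiR : (i : ℝ) + 1 ≤ m := by exact_mod_cast hi.le
    have hD : 0 < ((m : ℝ) + i + 1) * (1 - δ) * (((n : ℝ) - m + i + 2) * δ) := by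
      have : 0 < (n : ℝ) - m + i + 2 := by
        have : (0 : ℝ) ≤ i := i.cast_nonneg
        linarith
      positivity
    have hG : 0 ≤ ((m : ℝ) ^ 2 - ((i : ℝ) + 1) ^ 2) * (1 - δ) ^ 2 :=
      mul_nonneg (sub_nonneg.2 (pow_le_pow_left₀ (by positivity) hiR 2)) (by positivity)
    have h := binomialWeight_reflect_step (n := n) δ hi
    have ha := hw (m + i)
    constructor
    · intro hfi hgi
      refine nonneg_of_mul_nonneg_right ?_ hD
      exact h ▸ add_nonneg (mul_nonneg hG hfi) (mul_nonneg ha hgi)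
    · intro hfi hgi
      refine nonpos_of_mul_nonpos_right ?_ hD
      exact h ▸ add_nonpos (mul_nonpos_of_nonneg_of_nonpos hG hfi)
        (mul_nonpos_of_nonneg_of_nonpos ha hgi)
  rw [← sum_range_reflect]
  by_cases hk : m ≤ n - m + 1
  · have hkR : (m : ℝ) ≤ (n : ℝ) - m + 1 := by
      have : ((m + m : ℕ) : ℝ) ≤ ((n + 1 : ℕ) : ℝ) := by exact_mod_cast (by omega)
      push_cast at this
      linarith
    have hfnn : ∀ i, i < m → 0 ≤ f i := by
      intro i
      induction i with
      | zero => exact fun _ => hf0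
      | succ i ih =>
        intro hi
        refine (hstep i hi).1 (ih (by omega)) ?_
        have hiR : (i : ℝ) + 1 ≤ m := by exact_mod_cast hi.le
        have hi2 : ((i : ℝ) + 1) ^ 2 ≤ (m : ℝ) ^ 2 := pow_le_pow_left₀ (by positivity) hiR 2
        have hk2 : (m : ℝ) ^ 2 ≤ ((n : ℝ) - m + 1) ^ 2 := pow_le_pow_left₀ (by positivity) hkR 2
        simp only [hg]
        rcases le_total (δ ^ 2) ((1 - δ) ^ 2) with h | h
        · nlinarith [mul_nonneg (sq_nonneg ((i : ℝ) + 1)) (sub_nonneg.2 h)]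
        · have := mul_le_mul (sub_le_sub_right hk2 (((i : ℝ) + 1) ^ 2)) h (sq_nonneg _)
            (sub_nonneg.2 (hi2.trans hk2))
          linarith
    calc ∑ i ∈ range m, binomialWeight n δ (m - 1 - i)
        ≤ ∑ i ∈ range m, binomialWeight n δ (m + i) :=
          sum_le_sum fun i hi => sub_nonneg.1 (hfnn i (mem_range.1 hi))
      _ ≤ ∑ i ∈ range (n + 1), binomialWeight n δ (m + i) :=
          sum_le_sum_of_subset_of_nonneg (range_subset_range.2 (by omega)) fun i _ _ => hw _
  · have htrunc : ∀ c : ℕ → ℝ, ∑ i ∈ range (n + 1), c i * binomialWeight n δ (m + i) =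
        ∑ i ∈ range m, c i * binomialWeight n δ (m + i) := fun c => by
      symm
      refine sum_subset (range_subset_range.2 (by omega)) fun i _ hi => ?_
      rw [mem_range, not_lt] at hi
      rw [binomialWeight_of_lt δ (by omega), mul_zero]
    have htrunc_one : ∑ i ∈ range (n + 1), binomialWeight n δ (m + i) =
        ∑ i ∈ range m, binomialWeight n δ (m + i) := by
      simpa using htrunc fun _ => 1
    have hgneg : ∀ i j, i ≤ j → g i ≤ 0 → g j ≤ 0 := by
      intro i j hij hgi
      have hijR : ((i : ℝ) + 1) ^ 2 ≤ ((j : ℝ) + 1) ^ 2 :=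
        pow_le_pow_left₀ (by positivity) (by exact_mod_cast Nat.succ_le_succ hij) 2
      simp only [hg] at hgi ⊢
      have hslope : (1 - δ) ^ 2 ≤ δ ^ 2 := by
        by_contra! hcon
        have hi2 : 0 < ((i : ℝ) + 1) ^ 2 := by positivity
        nlinarith [mul_pos hi2 (sub_pos.2 hcon)]
      nlinarith [mul_nonneg (sub_nonneg.2 hijR) (sub_nonneg.2 hslope)]
    have hsign : ∀ i, i < m → f i < 0 → g i ≤ 0 := by
      intro i
      induction i with
      | zero => exact fun _ h => absurd hf0 h.not_ge
      | succ i ih =>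
        intro hi hneg
        refine hgneg i _ (Nat.le_succ i) ?_
        by_contra! hgi
        rcases lt_or_ge (f i) 0 with hfi | hfi
        · exact (ih (by omega) hfi).not_gt hgi
        · exact ((hstep i hi).1 hfi hgi.le).not_gt hneg
    have hcross : ∀ i j, i < j → j < m → f i < 0 → f j ≤ 0 := by
      intro i j hij hj hfi
      have hgi := hsign i (by omega) hfi
      induction j, hij.le using Nat.le_induction with
      | base => exact hfi.le
      | succ j hle ih =>
        rcases hle.eq_or_lt with rfl | hlt
        · exact (hstep _ hj).2 hfi.le hgi
        · exact (hstep j hj).2 (ih hlt (by omega)) (hgneg i j hle hgi)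
    have hreflect : ∑ i ∈ range m, (i : ℝ) * binomialWeight n δ (m - 1 - i) =
        ((m : ℝ) - 1) * ∑ j ∈ range m, binomialWeight n δ j -
          ∑ j ∈ range m, (j : ℝ) * binomialWeight n δ j := by
      rw [← sum_range_reflect, mul_sum, ← sum_sub_distrib]
      refine sum_congr rfl fun j hj => ?_
      have hj := mem_range.1 hj
      rw [show m - 1 - (m - 1 - j) = j by omega, Nat.sub_sub, Nat.cast_sub (by omega)]
      push_cast
      ring
    have hsum : 0 ≤ ∑ i ∈ range m, (i : ℝ) * f i := by
      have hnonneg : 0 ≤ ∑ j ∈ range m, binomialWeight n δ j := sum_nonneg fun j _ => hw j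
      simp only [hf, mul_sub, sum_sub_distrib]
      rw [hreflect, ← htrunc fun i => (i : ℝ)]
      simp only [add_mul, sum_add_distrib, ← mul_sum] at hmean
      linarith [congrArg ((m : ℝ) * ·) htotal]
    have := sum_nonneg_of_single_crossing hf0 hcross hsum
    rw [htrunc_one]
    simpa [hf, sum_sub_distrib] using this

open Finset in
/-- Local LYM inequality for the layers of an up-closed family of sets. -/
lemma card_filter_powersetCard_mul_le {n j : ℕ} {p : Finset (Fin n) → Prop}
    (hp : ∀ S T, S ⊆ T → p S → p T) :
    #((powersetCard j univ).filter p) * (n - j) ≤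
      #((powersetCard (j + 1) univ).filter p) * (j + 1) := by
  refine card_mul_le_card_mul (· ⊆ ·) (fun S hS => ?_) fun T hT => ?_
  · simp only [mem_filter, mem_powersetCard_univ] at hS
    have hcard : n - j = #(Sᶜ.image fun a => insert a S) := by
      rw [card_image_of_injOn, card_compl, Fintype.card_fin, hS.1]
      simpa using S.insert_inj_on
    rw [hcard]
    refine card_le_card fun T hT => ?_
    simp only [mem_image, mem_compl] at hT
    obtain ⟨a, ha, rfl⟩ := hT
    simp only [mem_bipartiteAbove, mem_filter, mem_powersetCard_univ]
    exact ⟨⟨by rw [card_insert_of_notMem ha, hS.1], hp _ _ (subset_insert a S) hS.2⟩,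
      subset_insert a S⟩
  · simp only [mem_filter, mem_powersetCard_univ] at hT
    calc _ ≤ #(powersetCard j T) := card_le_card fun S hS => by
          simp only [mem_bipartiteBelow, mem_filter, mem_powersetCard_univ] at hS
          exact mem_powersetCard.2 ⟨hS.2, hS.1.1⟩
      _ = j + 1 := by rw [card_powersetCard, hT.1, Nat.choose_succ_self_right]

lemma uniformSetProb_eq_div (n m : ℕ) (p : Finset (Fin n) → Prop) :
    uniformSetProb n m p =
      (((Finset.powersetCard m Finset.univ).filter p).card : ℝ) / n.choose m := by
  simp [uniformSetProb]

lemma uniformSetProb_nonneg (n m : ℕ) (p : Finset (Fin n) → Prop) :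
    0 ≤ uniformSetProb n m p := by
  unfold uniformSetProb
  positivity

lemma uniformSetProb_le_succ {n j : ℕ} {p : Finset (Fin n) → Prop}
    (hp : ∀ S T, S ⊆ T → p S → p T) (hj : j + 1 ≤ n) :
    uniformSetProb n j p ≤ uniformSetProb n (j + 1) p := by
  have h := card_filter_powersetCard_mul_le (j := j) hp
  have hc := Nat.choose_succ_right_eq n j
  have hpos : 0 < n.choose j := Nat.choose_pos (by omega)
  have hpos' : 0 < n.choose (j + 1) := Nat.choose_pos hj
  rw [uniformSetProb_eq_div, uniformSetProb_eq_div,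
    div_le_div_iff₀ (by exact_mod_cast hpos) (by exact_mod_cast hpos')]
  norm_cast
  refine Nat.le_of_mul_le_mul_right ?_ (Nat.add_one_pos j)
  calc _ = _ * (n - j) * n.choose j := by rw [mul_assoc, hc]; ring
    _ ≤ _ * (j + 1) * n.choose j := Nat.mul_le_mul_right _ h
    _ = _ := by ring

lemma uniformSetProb_mono {n j k : ℕ} {p : Finset (Fin n) → Prop}
    (hp : ∀ S T, S ⊆ T → p S → p T) (hjk : j ≤ k) (hk : k ≤ n) :
    uniformSetProb n j p ≤ uniformSetProb n k p := by
  induction k, hjk using Nat.le_induction with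
  | base => exact le_rfl
  | succ k _ ih => exact (ih (by omega)).trans (uniformSetProb_le_succ hp hk)

open Finset in
/-- Conditioning a Bernoulli random set on its cardinality gives a uniformly random set. -/
lemma bernSetProb_eq_sum (n : ℕ) (δ : ℝ) (p : Finset (Fin n) → Prop) :
    bernSetProb n δ p = ∑ j ∈ range (n + 1), binomialWeight n δ j * uniformSetProb n j p := by
  rw [bernSetProb, sum_filter, sum_powerset, card_fin]
  refine sum_congr rfl fun j hj => ?_
  have hpos : (n.choose j : ℝ) ≠ 0 := by
    exact_mod_cast (Nat.choose_pos (Nat.lt_succ_iff.1 (mem_range.1 hj))).ne'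
  rw [uniformSetProb_eq_div, binomialWeight, ← sum_filter,
    sum_congr rfl fun S hS => by rw [(mem_powersetCard_univ.1 (mem_filter.1 hS).1)],
    sum_const, nsmul_eq_mul]
  field_simp

open Finset in
/-- For an up-closed property, a uniformly random set of `⌊δ n⌋` elements is at most twice as
likely to satisfy it as a Bernoulli random set of mean `δ`. -/
theorem uniformSetProb_le_two_mul_bernSetProb {n : ℕ} {δ : ℝ} (h0 : 0 ≤ δ) (h1 : δ ≤ 1)
    {p : Finset (Fin n) → Prop} (hp : ∀ S T, S ⊆ T → p S → p T) :
    uniformSetProb n ⌊δ * (n : ℝ)⌋₊ p ≤ 2 * bernSetProb n δ p := by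
  have hm : (⌊δ * (n : ℝ)⌋₊ : ℝ) ≤ δ * n := Nat.floor_le (by positivity)
  generalize ⌊δ * (n : ℝ)⌋₊ = m at hm
  have hw := binomialWeight_nonneg n h0 h1
  have hq := uniformSetProb_nonneg n m p
  have hhalf := half_le_sum_binomialWeight h0 h1 hm
  have hext : bernSetProb n δ p =
      ∑ j ∈ range (m + (n + 1)), binomialWeight n δ j * uniformSetProb n j p := by
    rw [bernSetProb_eq_sum]
    refine sum_subset (range_subset_range.2 (Nat.le_add_left _ _)) fun j _ hj => ?_
    rw [binomialWeight_of_lt δ (by simpa using hj), zero_mul]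
  have hle : (∑ i ∈ range (n + 1), binomialWeight n δ (m + i)) * uniformSetProb n m p ≤
      bernSetProb n δ p := by
    rw [hext, sum_range_add _ m, sum_mul]
    refine le_add_of_nonneg_of_le
      (sum_nonneg fun j _ => mul_nonneg (hw j) (uniformSetProb_nonneg n j p))
      (sum_le_sum fun i _ => ?_)
    rcases le_or_gt (m + i) n with h | h
    · exact mul_le_mul_of_nonneg_left (uniformSetProb_mono hp (Nat.le_add_right m i) h) (hw _)
    · simp [binomialWeight_of_lt δ h]
  linarith [mul_le_mul_of_nonneg_right hhalf hq]

open Finset in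
lemma uniformPairProb_eq_sum (n m₁ m₂ : ℕ) (p : Finset (Fin n) → Finset (Fin n) → Prop) :
    uniformPairProb n m₁ m₂ p =
      (∑ T ∈ powersetCard m₂ univ, uniformSetProb n m₁ fun S => p S T) /
        #(powersetCard m₂ (univ : Finset (Fin n))) := by
  unfold uniformPairProb uniformSetProb
  rw [← sum_div, div_div, Nat.cast_mul, card_filter, sum_product_right, Nat.cast_sum, mul_comm]
  simp only [card_filter]

open Finset in
lemma sum_mul_uniformSetProb (n m : ℕ) (δ : ℝ) (p : Finset (Fin n) → Finset (Fin n) → Prop) :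
    (∑ T ∈ powersetCard m univ, bernSetProb n δ fun S => p S T) /
        #(powersetCard m (univ : Finset (Fin n))) =
      ∑ S ∈ univ.powerset, δ ^ #S * (1 - δ) ^ (n - #S) * uniformSetProb n m (p S) := by
  unfold bernSetProb uniformSetProb
  simp only [sum_filter]
  rw [sum_comm, sum_div]
  refine sum_congr rfl fun S _ => ?_
  rw [← mul_div_assoc, ← sum_filter, sum_const, nsmul_eq_mul, mul_comm]

open Finset in
lemma bernPairProb_eq_sum (n : ℕ) (δ : ℝ) (p : Finset (Fin n) → Finset (Fin n) → Prop) :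
    bernPairProb n δ p =
      ∑ S ∈ univ.powerset, δ ^ #S * (1 - δ) ^ (n - #S) * bernSetProb n δ (p S) := by
  unfold bernPairProb bernSetProb
  rw [sum_filter, sum_product]
  refine sum_congr rfl fun S _ => ?_
  rw [mul_sum, sum_filter]

open Finset in
/-- Two independent copies of `uniformSetProb_le_two_mul_bernSetProb`. -/
theorem uniformPairProb_le_four_mul_bernPairProb {n : ℕ} {δ : ℝ} (h0 : 0 ≤ δ) (h1 : δ ≤ 1)
    {p : Finset (Fin n) → Finset (Fin n) → Prop}
    (hleft : ∀ S S' T, S ⊆ S' → p S T → p S' T) (hright : ∀ S T T', T ⊆ T' → p S T → p S T') :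
    uniformPairProb n ⌊δ * (n : ℝ)⌋₊ ⌊δ * (n : ℝ)⌋₊ p ≤ 4 * bernPairProb n δ p := by
  have h1' := sub_nonneg.2 h1
  set m := ⌊δ * (n : ℝ)⌋₊
  calc uniformPairProb n m m p
      ≤ (∑ T ∈ powersetCard m univ, 2 * bernSetProb n δ fun S => p S T) /
          #(powersetCard m (univ : Finset (Fin n))) := by
        rw [uniformPairProb_eq_sum]
        gcongr with T
        exact uniformSetProb_le_two_mul_bernSetProb h0 h1 fun S S' h => hleft S S' T h
    _ = 2 * ∑ S ∈ univ.powerset, δ ^ #S * (1 - δ) ^ (n - #S) * uniformSetProb n m (p S) := by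
        rw [← mul_sum, mul_div_assoc, sum_mul_uniformSetProb]
    _ ≤ 2 * ∑ S ∈ univ.powerset, δ ^ #S * (1 - δ) ^ (n - #S) *
          (2 * bernSetProb n δ (p S)) := by
        gcongr with S
        exact uniformSetProb_le_two_mul_bernSetProb h0 h1 (hright S)
    _ = 4 * bernPairProb n δ p := by
        rw [bernPairProb_eq_sum, mul_sum, mul_sum]
        exact sum_congr rfl fun S _ => by ring

open scoped Matrix.Norms.L2Operator in
lemma specNorm_mul_le {n : ℕ} (A B : Matrix (Fin n) (Fin n) ℂ) :
    specNorm (A * B) ≤ specNorm A * specNorm B := by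
  have h := Matrix.l2_opNorm_mul A B
  simp only [Matrix.l2_opNorm_def] at h
  unfold specNorm
  convert h <;> rfl

lemma specNorm_nonneg {n : ℕ} (A : Matrix (Fin n) (Fin n) ℂ) : 0 ≤ specNorm A :=
  norm_nonneg _

open scoped Matrix.Norms.L2Operator in
lemma specNorm_projMatrix_le_one {n : ℕ} (S : Finset (Fin n)) :
    specNorm (projMatrix S) ≤ 1 := by
  have h : ‖projMatrix S‖ ≤ 1 := by
    rw [projMatrix, Matrix.l2_opNorm_diagonal]
    refine (pi_norm_le_iff_of_nonneg zero_le_one).2 fun i => ?_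
    split_ifs <;> simp
  rw [Matrix.l2_opNorm_def] at h
  unfold specNorm
  convert h
  rfl

lemma projMatrix_mul_of_subset {n : ℕ} {S T : Finset (Fin n)} (h : S ⊆ T) :
    projMatrix S * projMatrix T = projMatrix S := by
  rw [projMatrix, projMatrix, Matrix.diagonal_mul_diagonal]
  congr 1
  ext i
  by_cases hi : i ∈ S
  · simp [hi, h hi]
  · simp [hi]

lemma projMatrix_mul_of_superset {n : ℕ} {S T : Finset (Fin n)} (h : S ⊆ T) :
    projMatrix T * projMatrix S = projMatrix S := by
  rw [← projMatrix_mul_of_subset h]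
  simp only [projMatrix, Matrix.diagonal_mul_diagonal]
  congr 1
  ext i
  split_ifs <;> simp

lemma specNorm_projMatrix_mul_mono {n : ℕ} {S T : Finset (Fin n)} (h : S ⊆ T)
    (A : Matrix (Fin n) (Fin n) ℂ) :
    specNorm (projMatrix S * A) ≤ specNorm (projMatrix T * A) := by
  rw [← projMatrix_mul_of_subset h, Matrix.mul_assoc]
  exact (specNorm_mul_le _ _).trans
    (mul_le_of_le_one_left (specNorm_nonneg _) (specNorm_projMatrix_le_one S))

lemma specNorm_mul_projMatrix_mono {n : ℕ} {S T : Finset (Fin n)} (h : S ⊆ T)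
    (A : Matrix (Fin n) (Fin n) ℂ) :
    specNorm (A * projMatrix S) ≤ specNorm (A * projMatrix T) := by
  rw [← projMatrix_mul_of_superset h, ← Matrix.mul_assoc]
  exact (specNorm_mul_le _ _).trans
    (mul_le_of_le_one_right (specNorm_nonneg _) (specNorm_projMatrix_le_one S))

/-- **Random coordinate models.**  Fix `δ ∈ [0,1]` and an arbitrary `n × n` matrix `A`.  Then
for every `u ≥ 0`, `P(‖P_δ A‖ ≥ u) ≤ 2 P(‖R_δ A‖ ≥ u)`, and consequently
`P(‖P_δ A P'_δ‖ ≥ u) ≤ 4 P(‖R_δ A R'_δ‖ ≥ u)`, where `P_δ` projects onto a uniformly random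
set of exactly `⌊δn⌋` coordinates and `R_δ` onto an independent-Bernoulli(δ) set of
coordinates, primed matrices denoting independent copies. -/
theorem stmt_14 (n : ℕ) (δ : ℝ) (hδ0 : 0 ≤ δ) (hδ1 : δ ≤ 1)
    (A : Matrix (Fin n) (Fin n) ℂ) (u : ℝ) (hu : 0 ≤ u) :
    uniformSetProb n ⌊δ * (n : ℝ)⌋₊ (fun S => u ≤ specNorm (projMatrix S * A)) ≤
        2 * bernSetProb n δ (fun S => u ≤ specNorm (projMatrix S * A)) ∧
      uniformPairProb n ⌊δ * (n : ℝ)⌋₊ ⌊δ * (n : ℝ)⌋₊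
          (fun S S' => u ≤ specNorm (projMatrix S * A * projMatrix S')) ≤
        4 * bernPairProb n δ
          (fun S S' => u ≤ specNorm (projMatrix S * A * projMatrix S')) := by
  refine ⟨uniformSetProb_le_two_mul_bernSetProb hδ0 hδ1 fun S T h hS =>
      hS.trans (specNorm_projMatrix_mul_mono h A),
    uniformPairProb_le_four_mul_bernPairProb hδ0 hδ1 (fun S S' T h hS => hS.trans ?_)
      fun S T T' h hT => hT.trans (specNorm_mul_projMatrix_mono h _)⟩
  rw [Matrix.mul_assoc, Matrix.mul_assoc]
  exact specNorm_projMatrix_mul_mono h _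
end
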